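/- arXiv:2303.12127 — 5 statements merged into one kernel-verified Lean document; each statement's English description precedes it below -/
import Mathlib

section
/- Let n, m ∈ ℕ, let X = {x ∈ ℝⁿ : lb_x ≤ x ≤ ub_x} and U = {u ∈ ℝᵐ : lb_u ≤ u ≤ ub_u} be box sets (inequalities componentwise), let 𝒬 = {Q⁽¹⁾, …, Q⁽ᴸ⁾} be a finite set of symmetric (2n+m+1) × (2n+m+1) real matrices, and let D : ℝ^{n+m} → Set(ℝⁿ) satisfy the incremental quadratic constraint: for all q, q' ∈ ℝ^{n+m}, all d ∈ D(q), all d' ∈ D(q'), and all Q ∈ 𝒬, the vector v = (1, q − q', d − d') satisfies vᵀ Q v ≥ 0. Let {(qⁱ_t, dⁱ_t)}_{i,t} be finitely many data points with qⁱ_t = (xⁱ_t, uⁱ_t) and dⁱ_t ∈ D(qⁱ_t). Suppose there exist λ > 0, a positive definite matrix S ∈ ℝ^{n×n}, a vector c ∈ ℝⁿ, matrices B_x ∈ ℝ^{n×n} and B_u ∈ ℝ^{m×m} with all entries nonnegative, and scalars τⁱ_{t,l} ≥ 0 such that for all x ∈ ℝⁿ, u ∈ ℝᵐ, z ∈ ℝⁿ,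 writing q = (x, u): λ·(1 − (z − c/λ)ᵀ (S/λ)⁻¹ (z − c/λ)) ≥ (lb_x − x)ᵀ (B_x + B_xᵀ)(x − ub_x) + (lb_u − u)ᵀ (B_u + B_uᵀ)(u − ub_u) + Σ_{i,t,l} τⁱ_{t,l} · wᵀ Q⁽ˡ⁾ w, where w = (1, q − qⁱ_t, z − dⁱ_t). Then for every x ∈ X, u ∈ U, and z ∈ D(x, u), one has (z − c/λ)ᵀ (S/λ)⁻¹ (z − c/λ) ≤ 1; i.e. the set 𝒟 = ⋃_{(x,u) ∈ X × U} D(x,u) is contained in the ellipsoid {z : (z − c/λ)ᵀ (S/λ)⁻¹ (z − c/λ) ≤ 1}. -/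
open Matrix

/-- The augmented vector `(1, q, z) ∈ ℝ^{1+(n+m)+n}` built from `q ∈ ℝ^{n+m}` and `z ∈ ℝⁿ`. -/
def aug (n m : ℕ) (q : Fin (n + m) → ℝ) (z : Fin n → ℝ) : Fin (1 + (n + m) + n) → ℝ :=
  Fin.append (Fin.append (fun _ : Fin 1 => (1 : ℝ)) q) z

theorem box_term_nonneg {k : ℕ} (lb ub x : Fin k → ℝ) (B : Matrix (Fin k) (Fin k) ℝ)
    (hB : ∀ i j, 0 ≤ B i j) (hx : ∀ i, lb i ≤ x i ∧ x i ≤ ub i) :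
    0 ≤ (lb - x) ⬝ᵥ ((B + Bᵀ) *ᵥ (x - ub)) := by
  unfold dotProduct
  refine Finset.sum_nonneg fun i _ => ?_
  refine mul_nonneg_of_nonpos_of_nonpos (sub_nonpos.2 (hx i).1) ?_
  unfold mulVec dotProduct
  refine Finset.sum_nonpos fun j _ => ?_
  exact mul_nonpos_of_nonneg_of_nonpos (add_nonneg (hB i j) (hB j i)) (sub_nonpos.2 (hx j).2)

/-- Theorem 1 of the paper, S-procedure certificate of the ellipsoidal
outer-approximation: if the S-procedure certificate inequality holds for all `(x,u,z)`,
then every disturbance realizable within the box constraints lies in the ellipsoid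
`{z : (z − c/λ)ᵀ (S/λ)⁻¹ (z − c/λ) ≤ 1}`. -/
theorem ellipsoid_outer_approx
    (n m N T L : ℕ)
    (lbx ubx : Fin n → ℝ) (lbu ubu : Fin m → ℝ)
    (Qmat : Fin L → Matrix (Fin (1 + (n + m) + n)) (Fin (1 + (n + m) + n)) ℝ)
    (hsymm : ∀ l, (Qmat l).IsSymm)
    (D : (Fin (n + m) → ℝ) → Set (Fin n → ℝ))
    (hQC : ∀ q q' : Fin (n + m) → ℝ, ∀ d ∈ D q, ∀ d' ∈ D q', ∀ l : Fin L,
      0 ≤ aug n m (q - q') (d - d') ⬝ᵥ (Qmat l *ᵥ aug n m (q - q') (d - d')))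
    (qd : Fin N → Fin T → Fin (n + m) → ℝ) (dd : Fin N → Fin T → Fin n → ℝ)
    (xd : Fin N → Fin T → Fin n → ℝ) (ud : Fin N → Fin T → Fin m → ℝ)
    (hq : ∀ i t, qd i t = Fin.append (xd i t) (ud i t))
    (hdata : ∀ i t, dd i t ∈ D (qd i t))
    (lam : ℝ) (hlam : 0 < lam)
    (S : Matrix (Fin n) (Fin n) ℝ) (hS : S.PosDef)
    (c : Fin n → ℝ)
    (Bx : Matrix (Fin n) (Fin n) ℝ) (Bu : Matrix (Fin m) (Fin m) ℝ)
    (hBx : ∀ i j, 0 ≤ Bx i j) (hBu : ∀ i j, 0 ≤ Bu i j)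
    (τ : Fin N → Fin T → Fin L → ℝ) (hτ : ∀ i t l, 0 ≤ τ i t l)
    (hmain : ∀ (x : Fin n → ℝ) (u : Fin m → ℝ) (z : Fin n → ℝ),
      (lbx - x) ⬝ᵥ ((Bx + Bxᵀ) *ᵥ (x - ubx))
        + (lbu - u) ⬝ᵥ ((Bu + Buᵀ) *ᵥ (u - ubu))
        + ∑ i : Fin N, ∑ t : Fin T, ∑ l : Fin L, τ i t l *
            (aug n m (Fin.append x u - qd i t) (z - dd i t) ⬝ᵥ
              (Qmat l *ᵥ aug n m (Fin.append x u - qd i t) (z - dd i t)))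
      ≤ lam * (1 - (z - lam⁻¹ • c) ⬝ᵥ ((lam⁻¹ • S)⁻¹ *ᵥ (z - lam⁻¹ • c)))) :
    ∀ (x : Fin n → ℝ) (u : Fin m → ℝ),
      (∀ i, lbx i ≤ x i ∧ x i ≤ ubx i) →
      (∀ i, lbu i ≤ u i ∧ u i ≤ ubu i) →
      ∀ z ∈ D (Fin.append x u),
        (z - lam⁻¹ • c) ⬝ᵥ ((lam⁻¹ • S)⁻¹ *ᵥ (z - lam⁻¹ • c)) ≤ 1 := by
  intro x u hx hu z hz
  have h1 := box_term_nonneg lbx ubx x Bx hBx hx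
  have h2 := box_term_nonneg lbu ubu u Bu hBu hu
  have h3 : 0 ≤ ∑ i : Fin N, ∑ t : Fin T, ∑ l : Fin L, τ i t l *
            (aug n m (Fin.append x u - qd i t) (z - dd i t) ⬝ᵥ
              (Qmat l *ᵥ aug n m (Fin.append x u - qd i t) (z - dd i t))) :=
    Finset.sum_nonneg fun i _ => Finset.sum_nonneg fun t _ => Finset.sum_nonneg fun l _ =>
      mul_nonneg (hτ i t l) (hQC _ _ z hz _ (hdata i t) l)
  have h4 := (add_nonneg (add_nonneg h1 h2) h3).trans (hmain x u z)
  have h5 := nonneg_of_mul_nonneg_right h4 hlam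
  linarith
end

section
/- Let n, m, R ∈ ℕ with R ≥ 1, let f : ℝⁿ × ℝᵐ → ℝⁿ, h : ℝⁿ → ℝᵐ, F_x : (ℝᵐ)ᴿ → ℝⁿ, and F_u : (ℝᵐ)^{R+1} → ℝᵐ. Assume the flatness reconstruction law: for every x ∈ ℝⁿ and every u₀, …, u_{R−1} ∈ ℝᵐ, setting x₀ = x and x_{k+1} = f(x_k, u_k), one has F_x(h(x₀), …, h(x_{R−1})) = x₀ and F_u(h(x₀), …, h(x_R)) = u₀. Let X̄ ⊆ ℝⁿ and Ū ⊆ ℝᵐ, let I be a countable index set, and for each i ∈ I let {(x̄ⁱ_t, ūⁱ_t)}_{t∈ℕ} satisfy x̄ⁱ_{t+1} = f(x̄ⁱ_t, ūⁱ_t), x̄ⁱ_t ∈ X̄, and ūⁱ_t ∈ Ū for all t. Define ȳⁱ_t = (h(x̄ⁱ_t), …, h(x̄ⁱ_{t+R−1})) ∈ (ℝᵐ)ᴿ, Ȳⁱ_t = (h(x̄ⁱ_t), …, h(x̄ⁱ_{t+R})) ∈ (ℝᵐ)^{R+1}, and let CS be the convex hull of {ȳⁱ_t : i ∈ I, t ∈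 ℕ}. Assume further: (i) F_x maps the convex hull of {ȳⁱ_t} into X̄ and F_u maps the convex hull of {Ȳⁱ_t} into Ū; (ii) realizability: for every (y₀, …, y_R) in the convex hull of {Ȳⁱ_t}, setting x = F_x(y₀, …, y_{R−1}) and u = F_u(y₀, …, y_R), there exist u₁, …, u_{R−1} ∈ ℝᵐ such that the sequence x₀ = x, x₁ = f(x, u), x_{k+1} = f(x_k, u_k) for k = 1, …, R−1 satisfies h(x_k) = y_k for k = 0, …, R. Then for every ȳ = (y₀, …, y_{R−1}) ∈ CS there exists y_R ∈ ℝᵐ such that (y₁, …, y_R) ∈ CS, F_x(ȳ) ∈ X̄, F_u(y₀, …, y_R) ∈ Ū, and F_x(y₁, …, y_R) = f(F_x(ȳ), F_u(y₀, …, y_R)) ∈ X̄. -/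
/-- The state trajectory of the nominal system `x_{k+1} = f(x_k, u_k)` started at `x`. -/
def traj {n m : ℕ} (f : (Fin n → ℝ) × (Fin m → ℝ) → Fin n → ℝ)
    (x : Fin n → ℝ) (u : ℕ → Fin m → ℝ) : ℕ → Fin n → ℝ
  | 0 => x
  | k + 1 => f (traj f x u k, u k)

/-- Proposition 4 of the paper: the convex output safe set `CS` built from
historical nominal trajectories is control invariant for the forward-time shift dynamics,
with the reconstructed states and inputs satisfying the tightened constraints. -/
theorem convex_output_safe_set_control_invariant
    (n m R : ℕ) (hR : 1 ≤ R)
    (f : (Fin n → ℝ) × (Fin m → ℝ) → Fin n → ℝ)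
    (h : (Fin n → ℝ) → Fin m → ℝ)
    (Fx : (Fin R → Fin m → ℝ) → Fin n → ℝ)
    (Fu : (Fin (R + 1) → Fin m → ℝ) → Fin m → ℝ)
    (hflat : ∀ (x : Fin n → ℝ) (u : ℕ → Fin m → ℝ),
      Fx (fun k : Fin R => h (traj f x u k)) = x ∧
      Fu (fun k : Fin (R + 1) => h (traj f x u k)) = u 0)
    (Xb : Set (Fin n → ℝ)) (Ub : Set (Fin m → ℝ))
    (I : Type*) [Countable I]
    (xs : I → ℕ → Fin n → ℝ) (us : I → ℕ → Fin m → ℝ)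
    (hdyn : ∀ i t, xs i (t + 1) = f (xs i t, us i t))
    (hxmem : ∀ i t, xs i t ∈ Xb) (humem : ∀ i t, us i t ∈ Ub)
    (hFx : ∀ y ∈ convexHull ℝ {y : Fin R → Fin m → ℝ |
        ∃ i t, y = fun k : Fin R => h (xs i (t + (k : ℕ)))}, Fx y ∈ Xb)
    (hFu : ∀ Y ∈ convexHull ℝ {Y : Fin (R + 1) → Fin m → ℝ |
        ∃ i t, Y = fun k : Fin (R + 1) => h (xs i (t + (k : ℕ)))}, Fu Y ∈ Ub)
    (hreal : ∀ Y ∈ convexHull ℝ {Y : Fin (R + 1) → Fin m → ℝ |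
        ∃ i t, Y = fun k : Fin (R + 1) => h (xs i (t + (k : ℕ)))},
      ∃ u : ℕ → Fin m → ℝ, u 0 = Fu Y ∧
        ∀ k : Fin (R + 1),
          h (traj f (Fx (fun j : Fin R => Y j.castSucc)) u (k : ℕ)) = Y k) :
    ∀ y ∈ convexHull ℝ {y : Fin R → Fin m → ℝ |
        ∃ i t, y = fun k : Fin R => h (xs i (t + (k : ℕ)))},
      ∃ yR : Fin m → ℝ,
        (fun k : Fin R => (Fin.snoc y yR : Fin (R+1) → Fin m → ℝ) k.succ) ∈
          convexHull ℝ {y : Fin R → Fin m → ℝ |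
            ∃ i t, y = fun k : Fin R => h (xs i (t + (k : ℕ)))} ∧
        Fx y ∈ Xb ∧
        Fu ((Fin.snoc y yR : Fin (R+1) → Fin m → ℝ)) ∈ Ub ∧
        Fx (fun k : Fin R => (Fin.snoc y yR : Fin (R+1) → Fin m → ℝ) k.succ) = f (Fx y, Fu ((Fin.snoc y yR : Fin (R+1) → Fin m → ℝ))) ∧
        Fx (fun k : Fin R => (Fin.snoc y yR : Fin (R+1) → Fin m → ℝ) k.succ) ∈ Xb := by
  intro y hy
  obtain ⟨Y, hY, hYy⟩ : ∃ Y ∈ convexHull ℝ {Y : Fin (R + 1) → Fin m → ℝ |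
        ∃ i t, Y = fun k : Fin (R + 1) => h (xs i (t + (k : ℕ)))},
        (fun j : Fin R => Y j.castSucc) = y := by
    have key := LinearMap.image_convexHull
      (LinearMap.funLeft ℝ (Fin m → ℝ) (Fin.castSucc : Fin R → Fin (R + 1)))
      {Y : Fin (R + 1) → Fin m → ℝ | ∃ i t, Y = fun k : Fin (R + 1) => h (xs i (t + (k : ℕ)))}
    have hy2 : y ∈ convexHull ℝ
        ((LinearMap.funLeft ℝ (Fin m → ℝ) (Fin.castSucc : Fin R → Fin (R + 1))) ''
        {Y : Fin (R + 1) → Fin m → ℝ |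
          ∃ i t, Y = fun k : Fin (R + 1) => h (xs i (t + (k : ℕ)))}) := by
      refine convexHull_mono ?_ hy
      rintro _ ⟨i, t, rfl⟩
      exact ⟨_, ⟨i, t, rfl⟩, rfl⟩
    rw [← key] at hy2
    obtain ⟨Y, hY, e⟩ := hy2
    exact ⟨Y, hY, e⟩
  have hsn : (Fin.snoc y (Y (Fin.last R)) : Fin (R+1) → Fin m → ℝ) = Y := by
    rw [← hYy]
    exact Fin.snoc_init_self Y
  have hsh : (fun k : Fin R => Y k.succ) ∈ convexHull ℝ {y : Fin R → Fin m → ℝ |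
            ∃ i t, y = fun k : Fin R => h (xs i (t + (k : ℕ)))} := by
    have key := LinearMap.image_convexHull
      (LinearMap.funLeft ℝ (Fin m → ℝ) (Fin.succ : Fin R → Fin (R + 1)))
      {Y : Fin (R + 1) → Fin m → ℝ | ∃ i t, Y = fun k : Fin (R + 1) => h (xs i (t + (k : ℕ)))}
    have h1 := Set.mem_image_of_mem
      (LinearMap.funLeft ℝ (Fin m → ℝ) (Fin.succ : Fin R → Fin (R + 1))) hY
    rw [key] at h1
    refine convexHull_mono ?_ h1
    rintro _ ⟨_, ⟨i, t, rfl⟩, rfl⟩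
    refine ⟨i, t + 1, ?_⟩
    funext k
    simp only [LinearMap.funLeft_apply, Fin.val_succ]
    congr 2
    omega
  refine ⟨Y (Fin.last R), ?_⟩
  rw [hsn]
  refine ⟨hsh, hFx y hy, hFu Y hY, ?_, hFx _ hsh⟩
  obtain ⟨u, hu0, hu⟩ := hreal Y hY
  rw [hYy] at hu
  have hshift : ∀ k, traj f (f (Fx y, u 0)) (fun j => u (j + 1)) k = traj f (Fx y) u (k + 1) := by
    intro k
    induction k with
    | zero => rfl
    | succ k ih => rw [traj, ih]; rfl
  have h2 := (hflat (f (Fx y, u 0)) (fun j => u (j + 1))).1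
  rw [← hu0]
  rw [← h2]
  congr 1
  · funext k
    rw [hshift, ← hu k.succ]
    rfl
end

section
/- Let d, D ∈ ℕ, let c : ℝᴰ → ℝ be convex, let p : ℕ → ℝᵈ, P : ℕ → ℝᴰ, C : ℕ → ℝ, let s : ℕ → ℕ, and let π₁, π₂ : ℝᴰ → ℝᵈ be linear maps such that for all i ∈ ℕ: π₁(P_i) = p_i, π₂(P_i) = p_{s(i)}, and C_{s(i)} = C_i − c(P_i). Define Q : ℝᵈ → ℝ ∪ {+∞} by Q(y) = inf { Σ_{i∈ℕ} λ_i C_i : λ : ℕ → ℝ finitely supported, λ_i ≥ 0 for all i, Σ_i λ_i = 1, Σ_i λ_i p_i = y }, with Q(y) = +∞ if no such λ exists. Let y ∈ ℝᵈ and suppose the infimum defining Q(y) is attained by some finitely supported feasible λ⋆. Set y⁺ = Σ_i λ⋆_i p_{s(i)} and Ȳ = Σ_i λ⋆_i P_i. Then Q(y⁺) ≤ Q(y) − c(Ȳ). -/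
/-- The barycentric value function `Q(y)`: the infimum of `Σ λ_i C_i` over all finitely
supported convex-combination weights `λ` representing `y` from the data points `p_i`,
with value `+∞` (the top of `EReal`) if `y` admits no such representation. -/
noncomputable def Qfun (d : ℕ) (p : ℕ → Fin d → ℝ) (C : ℕ → ℝ) (y : Fin d → ℝ) : EReal :=
  sInf {r : EReal | ∃ l : ℕ → ℝ, (Function.support l).Finite ∧ (∀ i, 0 ≤ l i) ∧
    (∑ᶠ i, l i) = 1 ∧ (∑ᶠ i, l i • p i) = y ∧ r = ((∑ᶠ i, l i * C i : ℝ) : EReal)}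

theorem aux_finsum {E : Type*} [AddCommGroup E] [Module ℝ E] (l : ℕ →₀ ℝ) (f : ℕ → E) :
    (∑ᶠ i, l i • f i) = l.sum fun i a => a • f i := by
  rw [Finsupp.sum]
  apply finsum_eq_sum_of_support_subset
  intro i hi
  simp only [Function.mem_support] at hi
  simp only [Finset.mem_coe, Finsupp.mem_support_iff]
  intro h
  exact hi (by rw [h, zero_smul])

theorem aux_push {E : Type*} [AddCommGroup E] [Module ℝ E] (l : ℕ →₀ ℝ) (s : ℕ → ℕ) (f : ℕ → E) :
    (∑ᶠ i, (l.mapDomain s) i • f i) = ∑ᶠ i, l i • f (s i) := by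
  rw [aux_finsum, aux_finsum l (fun i => f (s i)), Finsupp.sum_mapDomain_index]
  · intro b; exact zero_smul _ _
  · intro b x y; exact add_smul _ _ _

/-- Proposition 5(2) of the paper, abstract form: the barycentric value
function decreases by at least the stage cost along the shifted convex combination. -/
theorem barycentric_value_decrease
    (dd D : ℕ)
    (c : (Fin D → ℝ) → ℝ) (hc : ConvexOn ℝ Set.univ c)
    (p : ℕ → Fin dd → ℝ) (P : ℕ → Fin D → ℝ) (C : ℕ → ℝ) (s : ℕ → ℕ)
    (π₁ π₂ : (Fin D → ℝ) →ₗ[ℝ] (Fin dd → ℝ))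
    (hπ₁ : ∀ i, π₁ (P i) = p i) (hπ₂ : ∀ i, π₂ (P i) = p (s i))
    (hC : ∀ i, C (s i) = C i - c (P i))
    (y : Fin dd → ℝ) (lam : ℕ → ℝ)
    (hfin : (Function.support lam).Finite) (hnn : ∀ i, 0 ≤ lam i)
    (hsum : (∑ᶠ i, lam i) = 1) (hrep : (∑ᶠ i, lam i • p i) = y)
    (hopt : Qfun dd p C y = ((∑ᶠ i, lam i * C i : ℝ) : EReal)) :
    Qfun dd p C (∑ᶠ i, lam i • p (s i)) ≤
      Qfun dd p C y - ((c (∑ᶠ i, lam i • P i) : ℝ) : EReal) := by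
  obtain ⟨l, rfl⟩ : ∃ l : ℕ →₀ ℝ, (l : ℕ → ℝ) = lam := ⟨Finsupp.ofSupportFinite lam hfin, rfl⟩
  have h1 := aux_push l s (fun _ => (1 : ℝ))
  have h3 := aux_push l s C
  simp only [smul_eq_mul, mul_one] at h1 h3
  have hle : Qfun dd p C (∑ᶠ i, l i • p (s i)) ≤ ((∑ᶠ i, l i * C (s i) : ℝ) : EReal) := by
    apply sInf_le
    refine ⟨l.mapDomain s, Finsupp.hasFiniteSupport _, ?_, h1.trans hsum, aux_push l s p, by rw [h3]⟩
    intro j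
    rw [Finsupp.mapDomain, Finsupp.sum_apply]
    apply Finset.sum_nonneg
    intro i _
    simp only [Finsupp.single_apply]
    split_ifs
    · exact hnn i
    · exact le_rfl
  refine hle.trans ?_
  rw [hopt, ← EReal.coe_sub, EReal.coe_le_coe_iff]
  have e1 := aux_finsum l (fun i => C (s i))
  have e2 := aux_finsum l C
  have e4 := aux_finsum l (fun _ => (1 : ℝ))
  simp only [smul_eq_mul, mul_one] at e1 e2 e4
  rw [e1, e2, aux_finsum l P]
  have hj := hc.map_sum_le (t := l.support) (w := l) (p := P) (fun i _ => hnn i)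
    (e4.symm.trans hsum) (fun i _ => Set.mem_univ _)
  simp only [smul_eq_mul] at hj
  simp only [Finsupp.sum, hC, mul_sub, Finset.sum_sub_distrib]
  linarith
end

section
/- Let D ∈ ℕ, let c : ℝᴰ → ℝ be continuous with c(y) ≥ 0 for all y, let K ⊆ ℝᴰ be compact, let (Y_t)_{t∈ℕ} be a sequence in K, and let (J_t)_{t∈ℕ} be a sequence of nonnegative real numbers satisfying J_{t+1} ≤ J_t − c(Y_t) for all t ∈ ℕ. Then: (1) c(Y_t) → 0 as t → ∞; (2) the set G = {y ∈ K : c(y) = 0} is nonempty; and (3) dist_G(Y_t) → 0 as t → ∞. -/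
open Filter

/-- core convergence argument of Theorem 3 of the paper: if the
nonnegative value sequence `J` decreases by at least the stage cost `c(Y_t)` at each
step, with `Y_t` confined to a compact set, then the stage costs vanish, the zero set of
`c` in `K` is nonempty, and the sequence approaches this zero set. -/
theorem value_decrease_convergence
    (D : ℕ) (c : EuclideanSpace ℝ (Fin D) → ℝ) (hc : Continuous c)
    (hcnn : ∀ y, 0 ≤ c y)
    (K : Set (EuclideanSpace ℝ (Fin D))) (hK : IsCompact K)
    (Y : ℕ → EuclideanSpace ℝ (Fin D)) (hY : ∀ t, Y t ∈ K)
    (J : ℕ → ℝ) (hJnn : ∀ t, 0 ≤ J t)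
    (hdec : ∀ t, J (t + 1) ≤ J t - c (Y t)) :
    Tendsto (fun t => c (Y t)) atTop (nhds 0) ∧
    {y ∈ K | c y = 0}.Nonempty ∧
    Tendsto (fun t => Metric.infDist (Y t) {y ∈ K | c y = 0}) atTop (nhds 0) := by
  have h1 : Tendsto (fun t => c (Y t)) atTop (nhds 0) := by
    have hs : Summable (fun t => c (Y t)) := by
      apply summable_of_sum_range_le (c := J 0) (fun t => hcnn _)
      intro n
      have h : ∑ i ∈ Finset.range n, c (Y i) ≤ J 0 - J n := by
        induction n with
        | zero => simp
        | succ k ih =>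
          rw [Finset.sum_range_succ]
          linarith [hdec k]
      linarith [hJnn n]
    exact hs.tendsto_atTop_zero
  have key : ∀ ns : ℕ → ℕ, Tendsto ns atTop atTop →
      ∃ y ∈ {y ∈ K | c y = 0}, ∃ φ : ℕ → ℕ,
        Tendsto (fun n => Y (ns (φ n))) atTop (nhds y) := by
    intro ns hns
    obtain ⟨y, hy, φ, hφ, hlim⟩ := hK.tendsto_subseq (x := fun n => Y (ns n)) (fun n => hY _)
    refine ⟨y, ⟨hy, ?_⟩, φ, hlim⟩
    exact tendsto_nhds_unique ((hc.tendsto y).comp hlim)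
      (h1.comp (hns.comp hφ.tendsto_atTop))
  refine ⟨h1, ?_, ?_⟩
  · obtain ⟨y, hy, _⟩ := key id tendsto_id
    exact ⟨y, hy⟩
  · apply tendsto_of_subseq_tendsto
    intro ns hns
    obtain ⟨y, hy, φ, hlim⟩ := key ns hns
    refine ⟨φ, ?_⟩
    have h := ((Metric.continuous_infDist_pt {y ∈ K | c y = 0}).tendsto y).comp hlim
    rw [Metric.infDist_zero_of_mem hy] at h
    exact h
end

section
/- Let n, m, R, N ∈ ℕ with R ≥ 1 and N ≥ 1, let f : ℝⁿ × ℝᵐ → ℝⁿ, let K : ℝⁿ → ℝᵐ be a linear map, let X̄, X ⊆ ℝⁿ, Ū, U ⊆ ℝᵐ, E ⊆ ℝⁿ, let D : ℝⁿ × ℝᵐ → Set(ℝⁿ) be a set-valued map, let CS ⊆ (ℝᵐ)ᴿ, and let F_x : (ℝᵐ)ᴿ → ℝⁿ and F_u : (ℝᵐ)^{R+1} → ℝᵐ. Assume: (H0) X̄ ⊆ X ⊖ E and Ū ⊆ U ⊖ K(E); (H1) robust error invariance: for all x̄ ∈ X̄, ū ∈ Ū, e ∈ E, and d ∈ D(e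 + x̄, ū + K e), one has f(e + x̄, ū + K e) − f(x̄, ū) + d ∈ E; (H2) terminal invariance: for every ȳ = (y₀, …, y_{R−1}) ∈ CS there exists y_R ∈ ℝᵐ such that (y₁, …, y_R) ∈ CS, F_x(ȳ) ∈ X̄, u' = F_u(y₀, …, y_R) ∈ Ū, and F_x(y₁, …, y_R) = f(F_x(ȳ), u'). Say a point x ∈ ℝⁿ is feasible if there exist x̄₀, …, x̄_N ∈ ℝⁿ, ū₀, …, ū_{N−1} ∈ ℝᵐ, and ȳ ∈ CS such that x̄_{k+1} = f(x̄_k, ū_k) for k = 0, …, N−1, x̄_k ∈ X̄ and ū_k ∈ Ū for k = 0, …, N−1, x̄_N = F_x(ȳ), and x − x̄₀ ∈ E. Then for every feasible x with witness (x̄₀, …, x̄_N, ū₀, …, ū_{N−1}, ȳ), setting u = ū₀ + K(x − x̄₀): x ∈ X, u ∈ U, and for every d ∈ D(x, u), the successor state f(x, u) + d is feasible. -/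
/-- Feasibility of the Robust Output-lifted LMPC optimization problem at the point `x`:
there is a nominal trajectory of length `N` within the tightened constraints, ending (via
the flat reconstruction map `Fx`) at a point of the convex output safe set `CS`, whose
initial state differs from `x` by an element of the error invariant `E`. -/
def Feasible (n m R N : ℕ)
    (f : (Fin n → ℝ) × (Fin m → ℝ) → Fin n → ℝ)
    (Xb : Set (Fin n → ℝ)) (Ub : Set (Fin m → ℝ)) (E : Set (Fin n → ℝ))
    (CS : Set (Fin R → Fin m → ℝ))
    (Fx : (Fin R → Fin m → ℝ) → Fin n → ℝ)
    (x : Fin n → ℝ) : Prop :=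
  ∃ (xb : Fin (N + 1) → Fin n → ℝ) (ub : Fin N → Fin m → ℝ) (y : Fin R → Fin m → ℝ),
    y ∈ CS ∧
    (∀ k : Fin N, xb k.succ = f (xb k.castSucc, ub k)) ∧
    (∀ k : Fin N, xb k.castSucc ∈ Xb) ∧
    (∀ k : Fin N, ub k ∈ Ub) ∧
    xb (Fin.last N) = Fx y ∧
    x - xb 0 ∈ E

/-- Theorem 2 of the paper, one-step recursive feasibility and robust
constraint satisfaction: under the constraint-tightening, robust error invariance, and
terminal invariance hypotheses, every feasible point satisfies the state constraint, the
applied input satisfies the input constraint, and every disturbed successor state is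
again feasible. -/
theorem recursive_feasibility
    (n m R N : ℕ) (hR : 1 ≤ R) (hN : 1 ≤ N)
    (f : (Fin n → ℝ) × (Fin m → ℝ) → Fin n → ℝ)
    (K : (Fin n → ℝ) →ₗ[ℝ] (Fin m → ℝ))
    (Xb X : Set (Fin n → ℝ)) (Ub U : Set (Fin m → ℝ)) (E : Set (Fin n → ℝ))
    (D : (Fin n → ℝ) × (Fin m → ℝ) → Set (Fin n → ℝ))
    (CS : Set (Fin R → Fin m → ℝ))
    (Fx : (Fin R → Fin m → ℝ) → Fin n → ℝ)
    (Fu : (Fin (R + 1) → Fin m → ℝ) → Fin m → ℝ)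
    (h0x : Xb ⊆ {a : Fin n → ℝ | ∀ e ∈ E, a + e ∈ X})
    (h0u : Ub ⊆ {b : Fin m → ℝ | ∀ v ∈ K '' E, b + v ∈ U})
    (h1 : ∀ xb ∈ Xb, ∀ ub ∈ Ub, ∀ e ∈ E, ∀ d ∈ D (e + xb, ub + K e),
      f (e + xb, ub + K e) - f (xb, ub) + d ∈ E)
    (h2 : ∀ y ∈ CS, ∃ yR : Fin m → ℝ,
      (fun k : Fin R => (Fin.snoc y yR : Fin (R + 1) → Fin m → ℝ) k.succ) ∈ CS ∧
      Fx y ∈ Xb ∧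
      Fu (Fin.snoc y yR : Fin (R + 1) → Fin m → ℝ) ∈ Ub ∧
      Fx (fun k : Fin R => (Fin.snoc y yR : Fin (R + 1) → Fin m → ℝ) k.succ) =
        f (Fx y, Fu (Fin.snoc y yR : Fin (R + 1) → Fin m → ℝ))) :
    ∀ x : Fin n → ℝ,
    ∀ (xb : Fin (N + 1) → Fin n → ℝ) (ub : Fin N → Fin m → ℝ) (y : Fin R → Fin m → ℝ),
      y ∈ CS →
      (∀ k : Fin N, xb k.succ = f (xb k.castSucc, ub k)) →
      (∀ k : Fin N, xb k.castSucc ∈ Xb) →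
      (∀ k : Fin N, ub k ∈ Ub) →
      xb (Fin.last N) = Fx y →
      x - xb 0 ∈ E →
      x ∈ X ∧
      (ub ⟨0, hN⟩ + K (x - xb 0)) ∈ U ∧
      ∀ d ∈ D (x, ub ⟨0, hN⟩ + K (x - xb 0)),
        Feasible n m R N f Xb Ub E CS Fx
          (f (x, ub ⟨0, hN⟩ + K (x - xb 0)) + d) := by
  intro x xb ub y hy hdyn hX hU hlast hE
  obtain ⟨M, rfl⟩ : ∃ M, N = M + 1 := ⟨N - 1, by omega⟩
  have hX0 : xb 0 ∈ Xb := hX 0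
  have hU0 : ub 0 ∈ Ub := hU 0
  have hxe : x - xb 0 + xb 0 = x := sub_add_cancel _ _
  have hz : (⟨0, hN⟩ : Fin (M + 1)) = 0 := rfl
  rw [hz]
  refine ⟨?_, h0u hU0 _ ⟨_, hE, rfl⟩, ?_⟩
  · have := h0x hX0 _ hE
    rwa [add_comm, hxe] at this
  intro d hd
  have he := h1 _ hX0 _ hU0 _ hE d (by rw [hxe]; exact hd)
  rw [hxe] at he
  obtain ⟨yR, hCS, hFx, hFu, hstep⟩ := h2 y hy
  set u' := Fu (Fin.snoc y yR : Fin (R + 1) → Fin m → ℝ) with hu'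
  refine ⟨Fin.snoc (fun k : Fin (M + 1) => xb k.succ) (f (Fx y, u')),
    Fin.snoc (fun k : Fin M => ub k.succ) u', _, hCS, ?_, ?_, ?_, ?_, ?_⟩
  · intro k
    refine Fin.lastCases ?_ (fun j => ?_) k
    · rw [Fin.succ_last, Fin.snoc_last, Fin.snoc_castSucc, Fin.snoc_last, Fin.succ_last, hlast]
    · rw [Fin.succ_castSucc, Fin.snoc_castSucc, Fin.snoc_castSucc, Fin.snoc_castSucc, hdyn,
        Fin.succ_castSucc]
  · intro k
    rw [Fin.snoc_castSucc]
    refine Fin.lastCases ?_ (fun j => ?_) k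
    · rw [Fin.succ_last, hlast]; exact hFx
    · rw [Fin.succ_castSucc]; exact hX _
  · intro k
    refine Fin.lastCases ?_ (fun j => ?_) k
    · rw [Fin.snoc_last]; exact hFu
    · rw [Fin.snoc_castSucc]; exact hU _
  · rw [Fin.snoc_last, hstep]
  · have h3 : (Fin.snoc (fun k : Fin (M + 1) => xb k.succ) (f (Fx y, u')) :
        Fin (M + 1 + 1) → Fin n → ℝ) 0 = f (xb 0, ub 0) := by
      rw [← Fin.castSucc_zero, Fin.snoc_castSucc, hdyn, Fin.castSucc_zero]
    rw [h3, add_sub_right_comm]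
    exact he
end
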